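/- Suppose q belongs to V but not to the closure of U. Then every x ∈ V_q ∖ U_q has countably infinitely many expansions in base q, and the greedy expansion of x in base q is finite (has only finitely many nonzero terms). -/

import Mathlib

open Classical

noncomputable section

/-- The largest digit in base `q`: `α₁ = ⌈q⌉ - 1`. -/
def alphaOne (q : ℝ) : ℕ := (⌈q⌉ - 1).toNat

/-- `c` (0-indexed: `c i` is the digit `c_{i+1}` of the paper) is an expansion of `x`
in base `q`: all digits lie in `{0, …, α₁}` and `x = ∑_{i≥1} c_i q^{-i}`. -/
def IsExpansionOf (q x : ℝ) (c : ℕ → ℕ) : Prop :=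
  (∀ i, c i ≤ alphaOne q) ∧ x = ∑' i, (c i : ℝ) / q ^ (i + 1)

/-- A sequence is called infinite if it has infinitely many nonzero terms. -/
def InfiniteSeq (c : ℕ → ℕ) : Prop := {i | c i ≠ 0}.Infinite

/-- Strict lexicographic order on sequences. -/
def LexLt (a b : ℕ → ℕ) : Prop := ∃ n, (∀ i, i < n → a i = b i) ∧ a n < b n

/-- Lexicographic order `≤` on sequences. -/
def LexLe (a b : ℕ → ℕ) : Prop := LexLt a b ∨ a = b

/-- `b` is the greedy (lexicographically largest) expansion of `x` in base `q`. -/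
def IsGreedyOf (q x : ℝ) (b : ℕ → ℕ) : Prop :=
  IsExpansionOf q x b ∧ ∀ c, IsExpansionOf q x c → LexLe c b

/-- `a` is the quasi-greedy (lexicographically largest infinite) expansion of `x`
in base `q`. -/
def IsQuasiGreedyOf (q x : ℝ) (a : ℕ → ℕ) : Prop :=
  IsExpansionOf q x a ∧ InfiniteSeq a ∧
    ∀ c, IsExpansionOf q x c → InfiniteSeq c → LexLe c a

/-- The quasi-greedy expansion of `x` in base `q`; by convention it is the zero
sequence whenever no infinite expansion exists (in particular for `x = 0`). -/
def quasiGreedy (q x : ℝ) : ℕ → ℕ :=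
  if h : ∃ a, IsQuasiGreedyOf q x a then h.choose else fun _ => 0

/-- The greedy expansion of `x` in base `q` (zero sequence if `x` has no expansion). -/
def greedy (q x : ℝ) : ℕ → ℕ :=
  if h : ∃ b, IsGreedyOf q x b then h.choose else fun _ => 0

/-- The interval `J_q = [0, α₁/(q-1)]`. -/
def Jq (q : ℝ) : Set ℝ := Set.Icc 0 ((alphaOne q : ℝ) / (q - 1))

/-- `U_q`: the set of real numbers having exactly one expansion in base `q`. -/
def Uq (q : ℝ) : Set ℝ := {x | ∃! c, IsExpansionOf q x c}

/-- `U_q'`: the set of univoque sequences in base `q`. -/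
def UqSeq (q : ℝ) : Set (ℕ → ℕ) := {c | ∃ x ∈ Uq q, IsExpansionOf q x c}

/-- `U`: the set of univoque numbers. -/
def USet : Set ℝ := {q | 1 < q ∧ ∃! c, IsExpansionOf q 1 c}

/-- `V_q`: the set of `x ∈ J_q` such that for every `n ≥ 1` with `a_n(x) > 0` the
conjugated shifted quasi-greedy expansion is lexicographically at most `(α_i)`. -/
def Vq (q : ℝ) : Set ℝ :=
  {x | x ∈ Jq q ∧ ∀ n, 0 < quasiGreedy q x n →
    LexLe (fun i => alphaOne q - quasiGreedy q x (n + 1 + i)) (quasiGreedy q 1)}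

/-- `V`: the set of `q > 1` whose quasi-greedy expansion `(α_i)` of `1` satisfies
`(α₁ - α_{k+i})_{i≥1} ≤ (α_i)_{i≥1}` lexicographically for all `k ≥ 1`. -/
def VSet : Set ℝ :=
  {q | 1 < q ∧ ∀ k, LexLe (fun i => alphaOne q - quasiGreedy q 1 (k + 1 + i)) (quasiGreedy q 1)}

/-! ### Lexicographic order -/

theorem lexLt_or_lexLt_of_ne {a b : ℕ → ℕ} (hab : a ≠ b) : LexLt a b ∨ LexLt b a := by
  have hex : ∃ n, a n ≠ b n := Function.ne_iff.mp hab
  have hbefore : ∀ i, i < Nat.find hex → a i = b i := fun i hi =>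
    not_not.mp (Nat.find_min hex hi)
  rcases lt_or_gt_of_ne (Nat.find_spec hex) with hlt | hgt
  · exact Or.inl ⟨_, hbefore, hlt⟩
  · exact Or.inr ⟨_, fun i hi => (hbefore i hi).symm, hgt⟩

theorem LexLt.asymm {a b : ℕ → ℕ} (hab : LexLt a b) (hba : LexLt b a) : False := by
  obtain ⟨m, hm, hm'⟩ := hab
  obtain ⟨n, hn, hn'⟩ := hba
  rcases lt_trichotomy m n with hmn | rfl | hmn
  · have := hn m hmn; omega
  · omega
  · have := hm n hmn; omega

theorem LexLt.ne {a b : ℕ → ℕ} (hab : LexLt a b) : a ≠ b := by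
  rintro rfl
  exact hab.asymm hab

theorem LexLe.antisymm {a b : ℕ → ℕ} (hab : LexLe a b) (hba : LexLe b a) : a = b := by
  rcases hab with hab | hab
  · rcases hba with hba | hba
    · exact (hab.asymm hba).elim
    · exact hba.symm
  · exact hab

theorem InfiniteSeq.exists_ne_zero {c : ℕ → ℕ} (hc : InfiniteSeq c) (n : ℕ) :
    ∃ i, c (n + i) ≠ 0 := by
  obtain ⟨m, hm, hnm⟩ := Set.Infinite.exists_gt hc n
  exact ⟨m - n, by rwa [Nat.add_sub_cancel' hnm.le]⟩

theorem infiniteSeq_of_forall_exists {c : ℕ → ℕ} (hc : ∀ n, ∃ i, c (n + i) ≠ 0) :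
    InfiniteSeq c := by
  refine Set.infinite_of_not_bddAbove fun ⟨B, hB⟩ => ?_
  obtain ⟨i, hi⟩ := hc (B + 1)
  have : B + 1 + i ≤ B := hB hi
  omega

/-! ### The value of a digit sequence -/

/-- The real number `∑ c_i q^{-i}` represented by a digit sequence in base `q`. -/
def digitValue (q : ℝ) (c : ℕ → ℕ) : ℝ := ∑' i, (c i : ℝ) / q ^ (i + 1)

theorem summable_const_div_pow {q : ℝ} (hq : 1 < q) (A : ℝ) :
    Summable fun i : ℕ => A / q ^ (i + 1) := by
  have hgeom := (summable_geometric_of_lt_one (inv_nonneg.mpr (by linarith : (0 : ℝ) ≤ q))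
    (inv_lt_one_of_one_lt₀ hq)).mul_left (A * q⁻¹)
  refine hgeom.congr fun i => ?_
  rw [inv_pow, pow_succ]
  field_simp

theorem summable_digits {q : ℝ} (hq : 1 < q) {A : ℕ} {c : ℕ → ℕ} (hc : ∀ i, c i ≤ A) :
    Summable fun i => (c i : ℝ) / q ^ (i + 1) := by
  refine Summable.of_nonneg_of_le (fun i => by positivity) (fun i => ?_)
    (summable_const_div_pow hq A)
  have : (c i : ℝ) ≤ A := by exact_mod_cast hc i
  gcongr

theorem digitValue_nonneg {q : ℝ} (hq : 1 < q) (c : ℕ → ℕ) : 0 ≤ digitValue q c :=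
  tsum_nonneg fun i => by positivity

theorem digitValue_pos {q : ℝ} (hq : 1 < q) {A : ℕ} {c : ℕ → ℕ} (hc : ∀ i, c i ≤ A)
    {n : ℕ} (hn : c n ≠ 0) : 0 < digitValue q c := by
  refine (summable_digits hq hc).tsum_pos (fun i => by positivity) n ?_
  have : 0 < c n := Nat.pos_of_ne_zero hn
  positivity

theorem digitValue_eq_zero {q : ℝ} (hq : 1 < q) {A : ℕ} {c : ℕ → ℕ} (hc : ∀ i, c i ≤ A)
    (h0 : digitValue q c = 0) (n : ℕ) : c n = 0 := by
  by_contra hn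
  exact (digitValue_pos hq hc hn).ne' h0

theorem digitValue_le {q : ℝ} (hq : 1 < q) {A : ℕ} {c : ℕ → ℕ} (hc : ∀ i, c i ≤ A) :
    digitValue q c ≤ digitValue q fun _ => A := by
  refine (summable_digits hq hc).tsum_le_tsum (fun i => ?_) (summable_const_div_pow hq A)
  have : (c i : ℝ) ≤ A := by exact_mod_cast hc i
  gcongr

theorem digitValue_eq_step {q : ℝ} (hq : 1 < q) {A : ℕ} {c : ℕ → ℕ} (hc : ∀ i, c i ≤ A) :
    q * digitValue q c = c 0 + digitValue q fun i => c (i + 1) := by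
  rw [digitValue, (summable_digits hq hc).tsum_eq_zero_add, digitValue, mul_add, ← tsum_mul_left]
  congr 1
  · field_simp
    ring
  · refine tsum_congr fun i => ?_
    field_simp
    ring

theorem digitValue_shift_step {q : ℝ} (hq : 1 < q) {A : ℕ} {c : ℕ → ℕ} (hc : ∀ i, c i ≤ A)
    (n : ℕ) : q * digitValue q (fun i => c (n + i)) =
      c n + digitValue q fun i => c (n + 1 + i) := by
  rw [digitValue_eq_step hq fun i => hc (n + i)]
  simp only [add_zero, add_assoc, add_comm 1]

theorem digitValue_sub_eq {q : ℝ} (hq : 1 < q) {A : ℕ} {c d : ℕ → ℕ} (hc : ∀ i, c i ≤ A)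
    (hd : ∀ i, d i ≤ A) (n : ℕ) (hcd : ∀ i, i < n → c i = d i) :
    q ^ n * (digitValue q c - digitValue q d) =
      digitValue q (fun i => c (n + i)) - digitValue q fun i => d (n + i) := by
  induction n with
  | zero => simp
  | succ n ih =>
    have hstep := ih fun i hi => hcd i (by omega)
    have hc' := digitValue_shift_step hq hc n
    have hd' := digitValue_shift_step hq hd n
    rw [hcd n (by omega)] at hc'
    rw [pow_succ, mul_right_comm, hstep]
    linarith

theorem digitValue_conj {q : ℝ} (hq : 1 < q) {A : ℕ} {c : ℕ → ℕ} (hc : ∀ i, c i ≤ A) :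
    digitValue q (fun i => A - c i) = digitValue q (fun _ => A) - digitValue q c := by
  rw [digitValue, digitValue, digitValue,
    ← (summable_const_div_pow hq A).tsum_sub (summable_digits hq hc)]
  refine tsum_congr fun i => ?_
  rw [Nat.cast_sub (hc i), sub_div]

theorem digitValue_const {q : ℝ} (hq : 1 < q) (A : ℕ) :
    digitValue q (fun _ => A) = A / (q - 1) := by
  have hstep := digitValue_eq_step hq (fun _ => le_refl A)
  rw [eq_div_iff (by linarith)]
  linarith

/-! ### Comparing values through the lexicographic order -/

/-- One step of the comparison of the value of `d` with the value `1` of `β`. -/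
theorem LexLt.digitValue_bound {q : ℝ} (hq : 1 < q) {A : ℕ} {β d : ℕ → ℕ} (hβ : ∀ i, β i ≤ A)
    (hβ1 : digitValue q β = 1) (hd : ∀ i, d i ≤ A) (hlt : LexLt d β) :
    ∃ j, d j < A ∧ q ^ (j + 1) * (digitValue q d - 1) ≤
      digitValue q (fun i => d (j + 1 + i)) - 1 - digitValue q fun i => β (j + 1 + i) := by
  obtain ⟨j, heq, hj⟩ := hlt
  refine ⟨j, hj.trans_le (hβ j), ?_⟩
  have hsub := digitValue_sub_eq hq hd hβ j heq
  have hd' := digitValue_shift_step hq hd j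
  have hβ' := digitValue_shift_step hq hβ j
  have hcast : (d j : ℝ) + 1 ≤ β j := by exact_mod_cast hj
  rw [hβ1] at hsub
  rw [pow_succ, mul_right_comm, hsub]
  linarith

theorem digitValue_le_one {q : ℝ} (hq : 1 < q) {A : ℕ} {β d : ℕ → ℕ} (hβ : ∀ i, β i ≤ A)
    (hβ1 : digitValue q β = 1) (hd : ∀ i, d i ≤ A) (hle : LexLe d β)
    (htail : ∀ n, d n < A → LexLe (fun i => d (n + 1 + i)) β) : digitValue q d ≤ 1 := by
  set C := digitValue q fun _ => A with hC
  have hC0 : 0 ≤ C := digitValue_nonneg hq _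
  have key : ∀ (N : ℕ) (e : ℕ → ℕ), (∀ i, e i ≤ A) → LexLe e β →
      (∀ n, e n < A → LexLe (fun i => e (n + 1 + i)) β) →
      q ^ N * (digitValue q e - 1) ≤ C := by
    intro N
    induction N with
    | zero =>
      intro e he _ _
      have := digitValue_le hq he
      simp only [pow_zero, one_mul]
      linarith
    | succ N ih =>
      intro e he hle htail
      rcases hle with hlt | rfl
      · obtain ⟨j, hj, hbound⟩ := hlt.digitValue_bound hq hβ hβ1 he
        have hih := ih _ (fun i => he (j + 1 + i)) (htail j hj) fun n hn => by
          simpa only [add_assoc] using htail _ hn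
        have hβ0 := digitValue_nonneg hq fun i => β (j + 1 + i)
        by_cases hpos : digitValue q e - 1 ≤ 0
        · exact (mul_nonpos_of_nonneg_of_nonpos (by positivity) hpos).trans hC0
        · have hqj : q ≤ q ^ (j + 1) := le_self_pow₀ hq.le (by omega)
          have h1 : q * (digitValue q e - 1) ≤ digitValue q (fun i => e (j + 1 + i)) - 1 := by
            nlinarith
          calc q ^ (N + 1) * (digitValue q e - 1) = q ^ N * (q * (digitValue q e - 1)) := by ring
            _ ≤ q ^ N * (digitValue q (fun i => e (j + 1 + i)) - 1) := by gcongr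
            _ ≤ C := hih
      · rw [hβ1, sub_self, mul_zero]
        exact hC0
  by_contra! hgt
  obtain ⟨N, hN⟩ := pow_unbounded_of_one_lt (C / (digitValue q d - 1)) hq
  rw [div_lt_iff₀ (by linarith)] at hN
  exact absurd (key N d hd hle htail) (not_le.mpr hN)

theorem digitValue_lt_one {q : ℝ} (hq : 1 < q) {A : ℕ} {β d : ℕ → ℕ} (hβ : ∀ i, β i ≤ A)
    (hβ1 : digitValue q β = 1) (hβinf : InfiniteSeq β) (hd : ∀ i, d i ≤ A) (hlt : LexLt d β)
    (htail : ∀ n, d n < A → LexLe (fun i => d (n + 1 + i)) β) : digitValue q d < 1 := by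
  obtain ⟨j, hj, hbound⟩ := hlt.digitValue_bound hq hβ hβ1 hd
  have hle := digitValue_le_one hq hβ hβ1 (fun i => hd (j + 1 + i)) (htail j hj) fun n hn => by
    simpa only [add_assoc] using htail _ hn
  obtain ⟨i, hi⟩ := hβinf.exists_ne_zero (j + 1)
  have hpos : 0 < digitValue q fun i => β (j + 1 + i) :=
    digitValue_pos hq (fun i => hβ (j + 1 + i)) hi
  have hneg : q ^ (j + 1) * (digitValue q d - 1) < 0 := by linarith
  have hqj : 0 < q ^ (j + 1) := by positivity
  nlinarith

/-- If the tails of `a` following nonmaximal digits are at most `β`, then an expansion that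
first deviates upwards from `a` can only be obtained by carrying a tail `β` of `a`. -/
theorem upward_deviation {q : ℝ} (hq : 1 < q) {A : ℕ} {β a c : ℕ → ℕ} (hβ : ∀ i, β i ≤ A)
    (hβ1 : digitValue q β = 1) (hβinf : InfiniteSeq β) (ha : ∀ i, a i ≤ A) (hc : ∀ i, c i ≤ A)
    (htail : ∀ n, a n < A → LexLe (fun i => a (n + 1 + i)) β)
    (hval : digitValue q c = digitValue q a) {n : ℕ} (heq : ∀ i, i < n → a i = c i)
    (hn : a n < c n) :
    (fun i => a (n + 1 + i)) = β ∧ c n = a n + 1 ∧ ∀ i, c (n + 1 + i) = 0 := by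
  have hsub := digitValue_sub_eq hq ha hc n heq
  rw [hval, sub_self, mul_zero] at hsub
  have ha' := digitValue_shift_step hq ha n
  have hc' := digitValue_shift_step hq hc n
  rw [sub_eq_zero.mp hsub.symm] at ha'
  have hc0 := digitValue_nonneg hq fun i => c (n + 1 + i)
  have hcast : (a n : ℝ) + 1 ≤ c n := by exact_mod_cast hn
  have htail' : ∀ m, a (n + 1 + m) < A → LexLe (fun i => a (n + 1 + (m + 1 + i))) β :=
    fun m hm => by simpa only [add_assoc] using htail _ hm
  have hbase := htail n (hn.trans_le (hc n))
  have hle := digitValue_le_one hq hβ hβ1 (fun i => ha (n + 1 + i)) hbase htail'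
  have hsum : digitValue q (fun i => a (n + 1 + i)) =
      (c n - a n) + digitValue q fun i => c (n + 1 + i) := by linarith
  refine ⟨hbase.resolve_left fun hlt => ?_, ?_,
    digitValue_eq_zero hq (fun i => hc (n + 1 + i)) (by linarith)⟩
  · have := digitValue_lt_one hq hβ hβ1 hβinf (fun i => ha (n + 1 + i)) hlt htail'
    linarith
  · have : (c n : ℝ) = a n + 1 := by linarith
    exact_mod_cast this

theorem downward_deviation {q : ℝ} (hq : 1 < q) {A : ℕ} {β a c : ℕ → ℕ} (hβ : ∀ i, β i ≤ A)
    (hβ1 : digitValue q β = 1) (hβinf : InfiniteSeq β) (ha : ∀ i, a i ≤ A) (hc : ∀ i, c i ≤ A)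
    (htail : ∀ n, 0 < a n → LexLe (fun i => A - a (n + 1 + i)) β)
    (hval : digitValue q c = digitValue q a) {n : ℕ} (heq : ∀ i, i < n → a i = c i)
    (hn : c n < a n) :
    (fun i => A - a (n + 1 + i)) = β ∧ a n = c n + 1 ∧ ∀ i, c (n + 1 + i) = A := by
  have han := ha n
  obtain ⟨h1, h2, h3⟩ := upward_deviation hq hβ hβ1 hβinf (a := fun i => A - a i)
    (c := fun i => A - c i) (fun i => Nat.sub_le _ _) (fun i => Nat.sub_le _ _)
    (fun m hm => htail m (by omega))
    (by rw [digitValue_conj hq ha, digitValue_conj hq hc, hval]) (n := n)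
    (fun i hi => by simp only [heq i hi]) (by omega)
  refine ⟨h1, by omega, fun i => ?_⟩
  have := h3 i
  have := hc (n + 1 + i)
  omega

/-! ### The quasi-greedy algorithm -/

theorem alphaOne_bounds {q : ℝ} (hq : 1 < q) :
    1 ≤ alphaOne q ∧ (alphaOne q : ℝ) < q ∧ q ≤ alphaOne q + 1 := by
  have hceil : 1 < ⌈q⌉ := Int.lt_ceil.mpr (by exact_mod_cast hq)
  have hcast : ((alphaOne q : ℕ) : ℤ) = ⌈q⌉ - 1 := Int.toNat_of_nonneg (by omega)
  have hcast' : (alphaOne q : ℝ) = ⌈q⌉ - 1 := by exact_mod_cast congrArg (Int.cast (R := ℝ)) hcast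
  refine ⟨by omega, ?_, ?_⟩
  · rw [hcast']; linarith [Int.ceil_lt_add_one q]
  · rw [hcast']; linarith [Int.le_ceil q]

theorem alphaOne_eq {p : ℝ} (hp : 1 < p) {A : ℕ} (hA : (A : ℝ) < p) (hA' : p ≤ A + 1) :
    alphaOne p = A := by
  obtain ⟨-, h1, h2⟩ := alphaOne_bounds hp
  have h3 : (alphaOne p : ℝ) < A + 1 := by linarith
  have h4 : (A : ℝ) < alphaOne p + 1 := by linarith
  norm_cast at h3 h4
  omega

/-- The largest admissible digit strictly below `q * r`. -/
def quasiGreedyDigit (q r : ℝ) : ℕ := min (alphaOne q) (⌈q * r⌉ - 1).toNat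

/-- The remainders of the quasi-greedy algorithm. -/
def quasiGreedyRem (q x : ℝ) : ℕ → ℝ
  | 0 => x
  | n + 1 => q * quasiGreedyRem q x n - quasiGreedyDigit q (quasiGreedyRem q x n)

/-- The digits produced by the quasi-greedy algorithm. -/
def quasiGreedySeq (q x : ℝ) (n : ℕ) : ℕ := quasiGreedyDigit q (quasiGreedyRem q x n)

theorem quasiGreedyDigit_le (q r : ℝ) : quasiGreedyDigit q r ≤ alphaOne q := min_le_left _ _

theorem quasiGreedySeq_le (q x : ℝ) (n : ℕ) : quasiGreedySeq q x n ≤ alphaOne q := min_le_left _ _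

theorem quasiGreedyDigit_lt {q r : ℝ} (hq : 1 < q) (hr : 0 < r) :
    (quasiGreedyDigit q r : ℝ) < q * r := by
  have hceil : 0 < ⌈q * r⌉ := Int.ceil_pos.mpr (by positivity)
  have hcast : (((⌈q * r⌉ - 1).toNat : ℕ) : ℤ) = ⌈q * r⌉ - 1 := Int.toNat_of_nonneg (by omega)
  have hcast' : (((⌈q * r⌉ - 1).toNat : ℕ) : ℝ) = ⌈q * r⌉ - 1 := by
    exact_mod_cast congrArg (Int.cast (R := ℝ)) hcast
  have hle : (quasiGreedyDigit q r : ℝ) ≤ ((⌈q * r⌉ - 1).toNat : ℕ) := by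
    exact_mod_cast min_le_right _ _
  linarith [Int.ceil_lt_add_one (q * r)]

theorem le_quasiGreedyDigit {q r : ℝ} {d : ℕ} (hd : d ≤ alphaOne q) (hdr : (d : ℝ) < q * r) :
    d ≤ quasiGreedyDigit q r := by
  have : (d : ℤ) < ⌈q * r⌉ := Int.lt_ceil.mpr (by exact_mod_cast hdr)
  exact le_min hd (by omega)

theorem quasiGreedyDigit_mono {q r s : ℝ} (hq : 1 < q) (hr : 0 < r) (hrs : r ≤ s) :
    quasiGreedyDigit q r ≤ quasiGreedyDigit q s :=
  le_quasiGreedyDigit (min_le_left _ _) ((quasiGreedyDigit_lt hq hr).trans_le (by gcongr))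

theorem sub_quasiGreedyDigit_le_one {q r : ℝ} (hd : quasiGreedyDigit q r < alphaOne q) :
    q * r - quasiGreedyDigit q r ≤ 1 := by
  by_contra! hgt
  have := le_quasiGreedyDigit (q := q) (r := r) (d := quasiGreedyDigit q r + 1) hd
    (by push_cast; linarith)
  omega

theorem quasiGreedyRem_mem {q x : ℝ} (hq : 1 < q) (hx : 0 < x)
    (hx' : x ≤ (alphaOne q : ℝ) / (q - 1)) (n : ℕ) :
    0 < quasiGreedyRem q x n ∧ quasiGreedyRem q x n ≤ (alphaOne q : ℝ) / (q - 1) := by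
  induction n with
  | zero => exact ⟨hx, hx'⟩
  | succ n ih =>
    refine ⟨sub_pos.mpr (quasiGreedyDigit_lt hq ih.1), ?_⟩
    obtain ⟨-, -, hA⟩ := alphaOne_bounds hq
    have hq1 : 0 < q - 1 := by linarith
    rw [le_div_iff₀ hq1] at *
    rcases (quasiGreedyDigit_le q (quasiGreedyRem q x n)).lt_or_eq with hlt | heq
    · have := sub_quasiGreedyDigit_le_one hlt
      simp only [quasiGreedyRem]
      nlinarith
    · simp only [quasiGreedyRem, heq]
      nlinarith [ih.2]

theorem quasiGreedyRem_add (q x : ℝ) (n i : ℕ) :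
    quasiGreedyRem q (quasiGreedyRem q x n) i = quasiGreedyRem q x (n + i) := by
  induction i with
  | zero => rfl
  | succ i ih => rw [← add_assoc, quasiGreedyRem, quasiGreedyRem, ih]

theorem quasiGreedySeq_shift (q x : ℝ) (n : ℕ) :
    (fun i => quasiGreedySeq q x (n + i)) = quasiGreedySeq q (quasiGreedyRem q x n) := by
  funext i
  simp only [quasiGreedySeq, quasiGreedyRem_add]

theorem digitValue_quasiGreedySeq {q x : ℝ} (hq : 1 < q) (hx : 0 < x)
    (hx' : x ≤ (alphaOne q : ℝ) / (q - 1)) : digitValue q (quasiGreedySeq q x) = x := by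
  have hd : ∀ i, quasiGreedySeq q x i ≤ alphaOne q := quasiGreedySeq_le q x
  have key : ∀ n, q ^ n * (digitValue q (quasiGreedySeq q x) - x) =
      digitValue q (fun i => quasiGreedySeq q x (n + i)) - quasiGreedyRem q x n := by
    intro n
    induction n with
    | zero => simp [quasiGreedyRem]
    | succ n ih =>
      have hstep := digitValue_shift_step hq hd n
      rw [pow_succ, mul_right_comm, ih, quasiGreedyRem]
      simp only [quasiGreedySeq] at *
      linarith
  have hbound : ∀ n, q ^ n * |digitValue q (quasiGreedySeq q x) - x| ≤
      (alphaOne q : ℝ) / (q - 1) := by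
    intro n
    have hrem := quasiGreedyRem_mem hq hx hx' n
    have hle := digitValue_le hq fun i => hd (n + i)
    have hnn := digitValue_nonneg hq fun i => quasiGreedySeq q x (n + i)
    rw [digitValue_const hq] at hle
    rw [← abs_of_pos (by positivity : 0 < q ^ n), ← abs_mul, key, abs_le]
    constructor <;> linarith
  by_contra hne
  have hpos : 0 < |digitValue q (quasiGreedySeq q x) - x| := abs_pos.mpr (sub_ne_zero.mpr hne)
  obtain ⟨N, hN⟩ := pow_unbounded_of_one_lt
    ((alphaOne q : ℝ) / (q - 1) / |digitValue q (quasiGreedySeq q x) - x|) hq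
  rw [div_lt_iff₀ hpos] at hN
  exact absurd (hbound N) (not_le.mpr hN)

theorem isQuasiGreedyOf_quasiGreedySeq {q x : ℝ} (hq : 1 < q) (hx : 0 < x)
    (hx' : x ≤ (alphaOne q : ℝ) / (q - 1)) : IsQuasiGreedyOf q x (quasiGreedySeq q x) := by
  have hd : ∀ i, quasiGreedySeq q x i ≤ alphaOne q := quasiGreedySeq_le q x
  have hval := digitValue_quasiGreedySeq hq hx hx'
  have htail : ∀ n, digitValue q (fun i => quasiGreedySeq q x (n + i)) =
      quasiGreedyRem q x n := fun n => by
    have hmem := quasiGreedyRem_mem hq hx hx' n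
    rw [quasiGreedySeq_shift, digitValue_quasiGreedySeq hq hmem.1 hmem.2]
  refine ⟨⟨hd, hval.symm⟩, infiniteSeq_of_forall_exists fun n => ?_, fun c hc hinf => ?_⟩
  · by_contra! hzero
    have hpos := (quasiGreedyRem_mem hq hx hx' n).1
    rw [← htail n] at hpos
    simp [digitValue, hzero] at hpos
  · by_contra hnot
    have hne : c ≠ quasiGreedySeq q x := fun heq => hnot (Or.inr heq)
    obtain ⟨n, heq, hn⟩ := (lexLt_or_lexLt_of_ne hne).resolve_left fun hlt => hnot (Or.inl hlt)
    have hsub := digitValue_sub_eq hq hd hc.1 n heq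
    rw [hval, show digitValue q c = x from hc.2.symm, sub_self, mul_zero, htail] at hsub
    have hstep := digitValue_shift_step hq hc.1 n
    obtain ⟨i, hi⟩ := hinf.exists_ne_zero (n + 1)
    have hpos : 0 < digitValue q fun i => c (n + 1 + i) :=
      digitValue_pos hq (fun i => hc.1 (n + 1 + i)) hi
    have hle : c n ≤ quasiGreedySeq q x n := le_quasiGreedyDigit (hc.1 n) (by
      rw [sub_eq_zero.mp hsub.symm]; linarith)
    omega

theorem quasiGreedy_eq {q x : ℝ} (hq : 1 < q) (hx : 0 < x)
    (hx' : x ≤ (alphaOne q : ℝ) / (q - 1)) : quasiGreedy q x = quasiGreedySeq q x := by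
  have hqg := isQuasiGreedyOf_quasiGreedySeq hq hx hx'
  have hex : ∃ a, IsQuasiGreedyOf q x a := ⟨_, hqg⟩
  rw [quasiGreedy, dif_pos hex]
  exact (hqg.2.2 _ hex.choose_spec.1 hex.choose_spec.2.1).antisymm
    (hex.choose_spec.2.2 _ hqg.1 hqg.2.1)

theorem quasiGreedySeq_mono {q x y : ℝ} (hq : 1 < q) (hx : 0 < x)
    (hx' : x ≤ (alphaOne q : ℝ) / (q - 1)) (hxy : x ≤ y) :
    LexLe (quasiGreedySeq q x) (quasiGreedySeq q y) := by
  by_contra hnot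
  have hne : quasiGreedySeq q x ≠ quasiGreedySeq q y := fun heq => hnot (Or.inr heq)
  obtain ⟨n, heq, hn⟩ := (lexLt_or_lexLt_of_ne hne).resolve_left fun hlt => hnot (Or.inl hlt)
  have hrem : ∀ m, m ≤ n → quasiGreedyRem q x m ≤ quasiGreedyRem q y m := by
    intro m
    induction m with
    | zero => exact fun _ => hxy
    | succ m ih =>
      intro hm
      have hih := ih (by omega)
      have hdig := heq m (by omega)
      simp only [quasiGreedySeq] at hdig
      rw [quasiGreedyRem, quasiGreedyRem, hdig]
      gcongr
  have := quasiGreedyDigit_mono hq (quasiGreedyRem_mem hq hx hx' n).1 (hrem n le_rfl)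
  simp only [quasiGreedySeq] at hn
  omega

theorem one_le_alphaOne_div {q : ℝ} (hq : 1 < q) : 1 ≤ (alphaOne q : ℝ) / (q - 1) := by
  rw [le_div_iff₀ (by linarith)]
  linarith [(alphaOne_bounds hq).2.2]

theorem quasiGreedySeq_tail_le {q x : ℝ} (hq : 1 < q) (hx : 0 < x)
    (hx' : x ≤ (alphaOne q : ℝ) / (q - 1)) {n : ℕ} (hn : quasiGreedySeq q x n < alphaOne q) :
    LexLe (fun i => quasiGreedySeq q x (n + 1 + i)) (quasiGreedySeq q 1) := by
  have hmem := quasiGreedyRem_mem hq hx hx' (n + 1)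
  rw [quasiGreedySeq_shift]
  exact quasiGreedySeq_mono hq hmem.1 hmem.2 (sub_quasiGreedyDigit_le_one hn)

theorem quasiGreedySeq_one_tail_le {q : ℝ} (hq : 1 < q) (n : ℕ) :
    LexLe (fun i => quasiGreedySeq q 1 (n + i)) (quasiGreedySeq q 1) := by
  have hmem := quasiGreedyRem_mem hq one_pos (one_le_alphaOne_div hq)
  have hrem : ∀ n, quasiGreedyRem q 1 n ≤ 1 := by
    intro n
    induction n with
    | zero => exact le_rfl
    | succ n ih =>
      rcases (quasiGreedyDigit_le q (quasiGreedyRem q 1 n)).lt_or_eq with hlt | heq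
      · exact sub_quasiGreedyDigit_le_one hlt
      · rw [quasiGreedyRem, heq]
        nlinarith [(alphaOne_bounds hq).2.2]
  rw [quasiGreedySeq_shift]
  exact quasiGreedySeq_mono hq (hmem n).1 (hmem n).2 (hrem n)

theorem quasiGreedySeq_one_zero {q : ℝ} (hq : 1 < q) : quasiGreedySeq q 1 0 = alphaOne q :=
  le_antisymm (min_le_left _ _) (le_quasiGreedyDigit le_rfl
    (by simpa [quasiGreedyRem] using (alphaOne_bounds hq).2.1))

/-! ### Approximating a strictly admissible sequence by univoque sequences -/

/-- The prefix of `α` of length `m` is lexicographically larger, letter by letter, than every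
conjugated suffix of itself of the same length. -/
def GoodPrefix (A : ℕ) (α : ℕ → ℕ) (m : ℕ) : Prop :=
  ∀ k, k < m → ∃ j, k + j < m ∧ (∀ i, i < j → A - α (k + i) = α i) ∧ A - α (k + j) < α j

/-- The sequence `v w w w …`, where `v` is the prefix of `α` of length `m`, and `w` is the
conjugate of `v` with its last digit increased by one. -/
def prefixConj (A : ℕ) (α : ℕ → ℕ) (m i : ℕ) : ℕ :=
  if i < m then α i else if i % m + 1 = m then A - α (i % m) + 1 else A - α (i % m)

theorem exists_goodPrefix {A : ℕ} {α : ℕ → ℕ} (hA : 0 < A) (hα0 : α 0 = A)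
    (hle : ∀ n, LexLe (fun i => α (n + i)) α)
    (hlt : ∀ n, LexLt (fun i => A - α (n + 1 + i)) α) (M : ℕ) :
    ∃ m, M ≤ m ∧ GoodPrefix A α m := by
  by_contra! hbad
  have hdiff : ∀ k, ∃ j, (∀ i, i < j → A - α (k + i) = α i) ∧ A - α (k + j) < α j := by
    rintro (_ | k)
    · exact ⟨0, by simp, by simp [hα0, hA]⟩
    · exact hlt k
  choose J hJ hJ' using hdiff
  -- a non-good prefix has a conjugated suffix that is again a prefix
  have hsuffix : ∀ m, ¬ GoodPrefix A α m →
      ∃ k, k < m ∧ ∀ i, k + i < m → A - α (k + i) = α i := by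
    intro m hm
    simp only [GoodPrefix, not_forall] at hm
    obtain ⟨k, hk, hno⟩ := hm
    refine ⟨k, hk, fun i hi => hJ k i ?_⟩
    by_contra hij
    have hlast := hJ' k
    exact hno ⟨J k, by omega, hJ k, hlast⟩
  -- the longest such suffix starts right after a good prefix
  have hshort : ∀ m, M ≤ m → ∃ k, k < M ∧ ∀ i, k + i < m → A - α (k + i) = α i := by
    intro m hm
    have hex := hsuffix m (hbad m hm)
    obtain ⟨hk, hkeq⟩ := Nat.find_spec hex
    have hmin := fun k hk => Nat.find_min hex (m := k) hk
    set k := Nat.find hex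
    refine ⟨k, ?_, hkeq⟩
    by_contra! hMk
    obtain ⟨l, hl, hleq⟩ := hsuffix k (hbad k hMk)
    refine hmin l hl ⟨by omega, fun i hi => ?_⟩
    have hbelow : ∀ j, l + j < m → (∀ i, i < j → A - α (l + i) = α i) → A - α (l + j) = α j := by
      intro j hj hprev
      by_cases hjk : l + j < k
      · exact hleq j hjk
      · obtain ⟨j', rfl⟩ : ∃ j', j = k - l + j' := ⟨j - (k - l), by omega⟩
        have hidx : l + (k - l + j') = k + j' := by omega
        have h1 : A - α (l + (k - l + j')) = α j' := by rw [hidx]; exact hkeq j' (by omega)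
        have h2 : ∀ i, i < j' → α (k - l + i) = α i := by
          intro i hi
          rw [← hprev (k - l + i) (by omega), show l + (k - l + i) = k + i by omega]
          exact hkeq i (by omega)
        have h3 : α (k - l + j') ≤ α j' := by
          rcases hle (k - l) with ⟨n, hn, hn'⟩ | heq
          · rcases lt_trichotomy j' n with h | rfl | h
            · exact (hn j' h).le
            · exact hn'.le
            · have := h2 n h
              beta_reduce at hn'
              omega
          · exact (congrFun heq j').le
        have h4 : A - α (l + (k - l + j')) ≤ α (k - l + j') := by
          rcases lt_trichotomy (k - l + j') (J l) with h | h | h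
          · exact (hJ l _ h).le
          · have := hJ' l
            simp only [← h] at this
            exact this.le
          · have := hprev _ h
            have := hJ' l
            omega
        omega
    induction i using Nat.strong_induction_on with
    | _ i ih => exact hbelow i hi fun i' hi' => ih i' hi' (by omega)
  obtain ⟨k, hk, hkeq⟩ := hshort (M + ∑ k ∈ Finset.range M, (k + J k) + 1) (by omega)
  have hsum : k + J k ≤ ∑ k ∈ Finset.range M, (k + J k) :=
    Finset.single_le_sum (f := fun k => k + J k) (fun _ _ => Nat.zero_le _)
      (Finset.mem_range.mpr hk)
  have := hkeq (J k) (by omega)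
  have := hJ' k
  omega

section PrefixConj

variable {A : ℕ} {α : ℕ → ℕ} {m : ℕ}

theorem GoodPrefix.last_pos (hm : GoodPrefix A α m) (hm2 : 2 ≤ m) (hα0 : α 0 = A) :
    0 < α (m - 1) := by
  obtain ⟨j, hj, -, hj'⟩ := hm (m - 1) (by omega)
  obtain rfl : j = 0 := by omega
  simp only [add_zero] at hj'
  omega

theorem prefixConj_of_lt {i : ℕ} (hi : i < m) : prefixConj A α m i = α i := if_pos hi

theorem prefixConj_block {t r : ℕ} (ht : 1 ≤ t) (hr : r + 1 < m) :
    prefixConj A α m (m * t + r) = A - α r := by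
  have hge : ¬ m * t + r < m := by nlinarith
  rw [prefixConj, if_neg hge, Nat.mul_add_mod, Nat.mod_eq_of_lt (by omega), if_neg (by omega)]

theorem prefixConj_block_last {t r : ℕ} (ht : 1 ≤ t) (hr : r + 1 = m) :
    prefixConj A α m (m * t + r) = A - α r + 1 := by
  have hge : ¬ m * t + r < m := by nlinarith
  rw [prefixConj, if_neg hge, Nat.mul_add_mod, Nat.mod_eq_of_lt (by omega), if_pos hr]

theorem prefixConj_le (hαA : ∀ i, α i ≤ A) (hm : GoodPrefix A α m) (hm2 : 2 ≤ m)
    (hα0 : α 0 = A) (i : ℕ) : prefixConj A α m i ≤ A := by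
  have hlast := hm.last_pos hm2 hα0
  have := hαA i
  have := hαA (m - 1)
  rw [prefixConj]
  split_ifs with h1 h2
  · assumption
  · rw [show i % m = m - 1 by omega]
    omega
  · omega

theorem prefixConj_shift_lt (hA : 0 < A) (hα0 : α 0 = A)
    (hle : ∀ n, LexLe (fun i => α (n + i)) α) (hm : GoodPrefix A α m) (hm2 : 2 ≤ m)
    (hαA : ∀ i, α i ≤ A) {k : ℕ} (hk : 0 < k) :
    LexLt (fun i => prefixConj A α m (k + i)) (prefixConj A α m) := by
  -- an occurrence of a prefix of `v` that is followed by the conjugate of `v` decides the order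
  have overlap : ∀ s t, 0 < s → s < m → 1 ≤ t →
      (∀ i, i < m - s → prefixConj A α m (k + i) = α i) → k + (m - s) = m * t →
      LexLt (fun i => prefixConj A α m (k + i)) (prefixConj A α m) := by
    intro s t hs hsm ht hpre hkt
    obtain ⟨j, hj, hj1, hj2⟩ := hm (m - s) (by omega)
    have hblock : ∀ i, i < s → prefixConj A α m (k + (m - s + i)) = A - α i := fun i hi => by
      rw [← add_assoc, hkt, prefixConj_block ht (by omega)]
    refine ⟨m - s + j, fun i hi => ?_, ?_⟩
    · by_cases him : i < m - s
      · simp only [hpre i him, prefixConj_of_lt (show i < m by omega)]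
      · obtain ⟨i', rfl⟩ : ∃ i', i = m - s + i' := ⟨i - (m - s), by omega⟩
        have := hj1 i' (by omega)
        have := hαA (m - s + i')
        simp only [hblock i' (by omega), prefixConj_of_lt (show m - s + i' < m by omega)]
        omega
    · have := hαA (m - s + j)
      have := hαA j
      simp only [hblock j (by omega), prefixConj_of_lt hj]
      omega
  by_cases hkm : k < m
  · by_cases hall : ∀ i, i < m - k → α (k + i) = α i
    · exact overlap k 1 hk hkm le_rfl (fun i hi => by
        rw [prefixConj_of_lt (by omega), hall i hi]) (by omega)
    · rcases hle k with ⟨j, hj, hj'⟩ | heq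
      · have hjm : k + j < m := by
          by_contra hge
          exact hall fun i hi => hj i (by omega)
        refine ⟨j, fun i hi => ?_, ?_⟩
        · simp only [prefixConj_of_lt (show k + i < m by omega),
            prefixConj_of_lt (show i < m by omega)]
          exact hj i hi
        · simpa only [prefixConj_of_lt hjm, prefixConj_of_lt (show j < m by omega)] using hj'
      · exact (hall fun i _ => congrFun heq i).elim
  · obtain ⟨t, s, ht, hs, rfl⟩ : ∃ t s, 1 ≤ t ∧ s < m ∧ k = m * t + s :=
      ⟨k / m, k % m, Nat.div_pos (by omega) (by omega), Nat.mod_lt _ (by omega),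
        (Nat.div_add_mod k m).symm⟩
    rcases Nat.eq_zero_or_pos s with rfl | hs0
    · refine ⟨0, by simp, ?_⟩
      simp only [add_zero, prefixConj_of_lt (show 0 < m by omega)]
      rw [← add_zero (m * t), prefixConj_block ht (by omega)]
      omega
    · obtain ⟨j, hj, hj1, hj2⟩ := hm s hs
      have hbefore : ∀ i, i < j → prefixConj A α m (m * t + s + i) = α i := fun i hi => by
        rw [add_assoc, prefixConj_block ht (by omega), hj1 i hi]
      by_cases hlast : s + j + 1 = m
      · have hjval : prefixConj A α m (m * t + s + j) = A - α (s + j) + 1 := by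
          rw [add_assoc, prefixConj_block_last ht hlast]
        by_cases hjeq : A - α (s + j) + 1 = α j
        · refine overlap s (t + 1) hs0 hs (by omega) (fun i hi => ?_) ?_
          · rcases (show i ≤ j by omega).lt_or_eq with h | rfl
            · exact hbefore i h
            · rw [hjval, hjeq]
          · rw [mul_add]; omega
        · refine ⟨j, fun i hi => ?_, ?_⟩
          · simp only [hbefore i hi, prefixConj_of_lt (show i < m by omega)]
          · simp only [hjval, prefixConj_of_lt (show j < m by omega)]
            omega
      · refine ⟨j, fun i hi => ?_, ?_⟩
        · simp only [hbefore i hi, prefixConj_of_lt (show i < m by omega)]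
        · simp only [prefixConj_of_lt (show j < m by omega)]
          rwa [add_assoc, prefixConj_block ht (by omega)]

theorem prefixConj_conj_shift_lt (hα0 : α 0 = A)
    (hle : ∀ n, LexLe (fun i => α (n + i)) α) (hm : GoodPrefix A α m) (hm2 : 2 ≤ m)
    (hαA : ∀ i, α i ≤ A) (k : ℕ) :
    LexLt (fun i => A - prefixConj A α m (k + i)) (prefixConj A α m) := by
  by_cases hkm : k < m
  · obtain ⟨j, hj, hj1, hj2⟩ := hm k hkm
    refine ⟨j, fun i hi => ?_, ?_⟩
    · simp only [prefixConj_of_lt (show k + i < m by omega), prefixConj_of_lt (show i < m by omega)]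
      exact hj1 i hi
    · simpa only [prefixConj_of_lt hj, prefixConj_of_lt (show j < m by omega)] using hj2
  · obtain ⟨t, s, ht, hs, rfl⟩ : ∃ t s, 1 ≤ t ∧ s < m ∧ k = m * t + s :=
      ⟨k / m, k % m, Nat.div_pos (by omega) (by omega), Nat.mod_lt _ (by omega),
        (Nat.div_add_mod k m).symm⟩
    have hlast := hm.last_pos hm2 hα0
    have hinner : ∀ i, s + i + 1 < m → A - prefixConj A α m (m * t + s + i) = α (s + i) := by
      intro i hi
      have := hαA (s + i)
      rw [add_assoc, prefixConj_block ht (by omega)]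
      omega
    have hend : A - prefixConj A α m (m * t + s + (m - 1 - s)) = α (m - 1) - 1 := by
      have := hαA (m - 1)
      rw [add_assoc, show s + (m - 1 - s) = m - 1 by omega, prefixConj_block_last ht (by omega)]
      omega
    -- locate the first difference between the suffix of `v` and its prefix, if any
    by_cases hall : ∀ i, s + i + 1 < m → α (s + i) = α i
    · refine ⟨m - 1 - s, fun i hi => ?_, ?_⟩
      · simp only [hinner i (by omega), hall i (by omega), prefixConj_of_lt (show i < m by omega)]
      · have hlast_le : α (m - 1) ≤ α (m - 1 - s) := by
          rcases hle s with ⟨j, hj, hj'⟩ | heq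
          · rcases lt_trichotomy (m - 1 - s) j with h | h | h
            · have := hj _ h
              simp only [show s + (m - 1 - s) = m - 1 by omega] at this
              exact this.le
            · simp only [← h, show s + (m - 1 - s) = m - 1 by omega] at hj'
              exact hj'.le
            · have := hall j (by omega)
              beta_reduce at hj'
              omega
          · have := congrFun heq (m - 1 - s)
            simp only [show s + (m - 1 - s) = m - 1 by omega] at this
            exact this.le
        simp only [hend, prefixConj_of_lt (show m - 1 - s < m by omega)]
        omega
    · rcases hle s with ⟨j, hj, hj'⟩ | heq
      · have hjm : s + j + 1 < m := by
          by_contra hge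
          exact hall fun i hi => hj i (by omega)
        refine ⟨j, fun i hi => ?_, ?_⟩
        · simp only [hinner i (by omega), prefixConj_of_lt (show i < m by omega)]
          exact hj i hi
        · simpa only [hinner j hjm, prefixConj_of_lt (show j < m by omega)] using hj'
      · exact (hall fun i _ => congrFun heq i).elim

end PrefixConj

/-! ### Univoque bases -/

theorem mem_USet_of_strict {p : ℝ} (hp : 1 < p) {A : ℕ} (hA : 0 < A) {γ : ℕ → ℕ}
    (hγA : ∀ i, γ i ≤ A) (hγ0 : γ 0 = A) (hγ1 : digitValue p γ = 1)
    (hlt : ∀ n, LexLt (fun i => γ (n + 1 + i)) γ)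
    (hltc : ∀ n, LexLt (fun i => A - γ (n + 1 + i)) γ) : p ∈ USet := by
  have hinf : InfiniteSeq γ := by
    refine infiniteSeq_of_forall_exists fun n => ?_
    by_contra! hzero
    obtain ⟨j, -, hj⟩ := hltc n
    have h1 := hzero (1 + j)
    have h2 := hγA j
    beta_reduce at hj
    rw [← add_assoc] at h1
    omega
  have hstep := digitValue_eq_step hp hγA
  have htail_pos : 0 < digitValue p fun i => γ (i + 1) := by
    obtain ⟨i, hi⟩ := hinf.exists_ne_zero 1
    exact digitValue_pos hp (fun i => hγA (i + 1)) (n := i) (by rwa [add_comm])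
  rw [hγ1, hγ0] at hstep
  have hAp : (A : ℝ) < p := by linarith
  have hpA : p ≤ A + 1 := by
    have hmax := digitValue_le hp hγA
    rw [hγ1, digitValue_const hp, le_div_iff₀ (by linarith)] at hmax
    linarith
  have hαp := alphaOne_eq hp hAp hpA
  refine ⟨hp, γ, ⟨by rwa [hαp], hγ1.symm⟩, fun c ⟨hcA, hc1⟩ => ?_⟩
  rw [hαp] at hcA
  have hval : digitValue p c = digitValue p γ := by rw [hγ1]; exact hc1.symm
  by_contra hne
  rcases lexLt_or_lexLt_of_ne hne with ⟨n, heq, hn⟩ | ⟨n, heq, hn⟩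
  · exact (hltc n).ne (downward_deviation hp hγA hγ1 hinf hγA hcA (fun n _ => Or.inl (hltc n))
      hval (fun i hi => (heq i hi).symm) hn).1
  · exact (hlt n).ne (upward_deviation hp hγA hγ1 hinf hγA hcA (fun n _ => Or.inl (hlt n))
      hval heq hn).1

theorem digitValue_anti {p r : ℝ} (hp : 1 < p) (hpr : p < r) {A : ℕ} {c : ℕ → ℕ}
    (hc : ∀ i, c i ≤ A) (hc0 : c 0 ≠ 0) : digitValue r c < digitValue p c := by
  have hr : 1 < r := hp.trans hpr
  refine Summable.tsum_lt_tsum (i := 0) (fun i => ?_) ?_ (summable_digits hr hc)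
    (summable_digits hp hc)
  · gcongr
  · have : 0 < c 0 := Nat.pos_of_ne_zero hc0
    simp only [zero_add, pow_one]
    gcongr

theorem tendsto_digitValue_of_prefix {p : ℝ} (hp : 1 < p) {A : ℕ} {α : ℕ → ℕ}
    {γ : ℕ → ℕ → ℕ} {S : Set ℕ} (hγA : ∀ m ∈ S, ∀ i, γ m i ≤ A)
    (hγ : ∀ m i, i < m → γ m i = α i) :
    Filter.Tendsto (fun m => digitValue p (γ m)) (Filter.atTop ⊓ Filter.principal S)
      (nhds (digitValue p α)) := by
  refine tendsto_tsum_of_dominated_convergence (summable_const_div_pow hp A) (fun i => ?_) ?_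
  · refine tendsto_const_nhds.congr' ?_
    filter_upwards [Filter.mem_inf_of_left (Filter.eventually_gt_atTop i)] with m hm
    rw [hγ m i hm]
  · filter_upwards [Filter.mem_inf_of_right (Filter.mem_principal_self S)] with m hm i
    have : (γ m i : ℝ) ≤ A := by exact_mod_cast hγA m hm i
    rw [Real.norm_of_nonneg (by positivity)]
    gcongr

theorem continuousOn_digitValue {p r : ℝ} (hp : 1 < p) {A : ℕ} {c : ℕ → ℕ}
    (hc : ∀ i, c i ≤ A) : ContinuousOn (fun s => digitValue s c) (Set.Icc p r) := by
  refine continuousOn_tsum (fun i => ?_) (summable_const_div_pow hp A) fun i s hs => ?_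
  · exact continuousOn_const.div (continuousOn_id.pow _) fun s hs =>
      pow_ne_zero _ (by linarith [hs.1, show id s = s from rfl])
  · have hs0 : 0 < s := by linarith [hs.1]
    have : (c i : ℝ) ≤ A := by exact_mod_cast hc i
    rw [Real.norm_of_nonneg (by positivity)]
    gcongr
    exact hs.1

theorem mem_closure_USet {q : ℝ} (hq : 1 < q)
    (hlt : ∀ n, LexLt (fun i => alphaOne q - quasiGreedySeq q 1 (n + 1 + i))
      (quasiGreedySeq q 1)) : q ∈ closure USet := by
  set A := alphaOne q
  set α := quasiGreedySeq q 1
  have hA : 0 < A := (alphaOne_bounds hq).1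
  have hα0 : α 0 = A := quasiGreedySeq_one_zero hq
  have hαA : ∀ i, α i ≤ A := quasiGreedySeq_le q 1
  have hle : ∀ n, LexLe (fun i => α (n + i)) α := quasiGreedySeq_one_tail_le hq
  have hα1 : digitValue q α = 1 := digitValue_quasiGreedySeq hq one_pos (one_le_alphaOne_div hq)
  rw [Metric.mem_closure_iff]
  intro ε hε
  obtain ⟨p, hp, hpq⟩ := exists_between (max_lt hq (sub_lt_self q hε))
  obtain ⟨r, hqr, hr⟩ := exists_between (lt_add_of_pos_right q hε)
  obtain ⟨hp1, hpε⟩ := max_lt_iff.mp hp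
  have hpval : 1 < digitValue p α := hα1 ▸ digitValue_anti hp1 hpq hαA (by omega)
  have hrval : digitValue r α < 1 := hα1 ▸ digitValue_anti hq hqr hαA (by omega)
  set S := {m | 2 ≤ m ∧ GoodPrefix A α m}
  have hγA : ∀ m ∈ S, ∀ i, prefixConj A α m i ≤ A := fun m hm =>
    prefixConj_le hαA hm.2 hm.1 hα0
  have hlim := fun (s : ℝ) (hs : 1 < s) =>
    tendsto_digitValue_of_prefix hs (γ := prefixConj A α) hγA
      fun m i hi => prefixConj_of_lt hi
  have hne : (Filter.atTop ⊓ Filter.principal S).NeBot := by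
    rw [← Filter.frequently_mem_iff_neBot, Filter.frequently_atTop]
    intro M
    obtain ⟨m, hm, hgood⟩ := exists_goodPrefix hA hα0 hle hlt (M + 2)
    exact ⟨m, by omega, by omega, hgood⟩
  obtain ⟨m, ⟨hmp, hmr⟩, hm2, hgood⟩ :=
    (((hlim p hp1).eventually_const_lt hpval).and
      ((hlim r (hq.trans hqr)).eventually_lt_const hrval)).and
      (Filter.mem_inf_of_right (Filter.mem_principal_self S)) |>.exists
  have hcont := continuousOn_digitValue (r := r) hp1 (hγA m ⟨hm2, hgood⟩)
  obtain ⟨s, hs, hs1⟩ := intermediate_value_Icc' (hpq.trans hqr).le hcont ⟨hmr.le, hmp.le⟩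
  refine ⟨s, mem_USet_of_strict (hp1.trans_le hs.1) hA (hγA m ⟨hm2, hgood⟩) ?_ hs1
    (fun n => prefixConj_shift_lt hA hα0 hle hgood hm2 hαA n.succ_pos)
    (fun n => prefixConj_conj_shift_lt hα0 hle hgood hm2 hαA (n + 1)), ?_⟩
  · rw [prefixConj_of_lt (by omega), hα0]
  · rw [Real.dist_eq, abs_lt]
    constructor <;> linarith [hs.1, hs.2]

/-! ### Expansions of numbers whose quasi-greedy expansion ends with that of one -/

/-- The sequence obtained from `a` by replacing the digit at `n` by `d` and all later digits
by `e`. -/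
def truncateWith (a : ℕ → ℕ) (n d e i : ℕ) : ℕ := if i < n then a i else if i = n then d else e

theorem eq_truncateWith {a c : ℕ → ℕ} {n e : ℕ} (heq : ∀ i, i < n → a i = c i)
    (htail : ∀ i, c (n + 1 + i) = e) : c = truncateWith a n (c n) e := by
  funext i
  rw [truncateWith]
  split_ifs with h1 h2
  · exact (heq i h1).symm
  · rw [h2]
  · rw [← htail (i - (n + 1)), Nat.add_sub_cancel' (by omega)]

theorem truncateWith_succ_isExpansionOf {q x : ℝ} (hq : 1 < q) {a : ℕ → ℕ}
    (ha : IsExpansionOf q x a) {n : ℕ} (hn : a n < alphaOne q)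
    (htail : digitValue q (fun i => a (n + 1 + i)) = 1) :
    IsExpansionOf q x (truncateWith a n (a n + 1) 0) := by
  have hbound : ∀ i, truncateWith a n (a n + 1) 0 i ≤ alphaOne q := fun i => by
    rw [truncateWith]
    split_ifs
    · exact ha.1 i
    · exact hn
    · exact Nat.zero_le _
  refine ⟨hbound, ?_⟩
  have hsub := digitValue_sub_eq hq hbound ha.1 (n + 1 - 1) fun i hi => if_pos (by omega)
  rw [Nat.add_sub_cancel] at hsub
  have hstep := digitValue_shift_step hq hbound n
  have hstep' := digitValue_shift_step hq ha.1 n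
  have hzero : digitValue q (fun i => truncateWith a n (a n + 1) 0 (n + 1 + i)) = 0 := by
    have : ∀ i, truncateWith a n (a n + 1) 0 (n + 1 + i) = 0 := fun i => by
      rw [truncateWith, if_neg (by omega), if_neg (by omega)]
    simp [digitValue, this]
  have hat : truncateWith a n (a n + 1) 0 n = a n + 1 := by
    rw [truncateWith, if_neg (lt_irrefl n), if_pos rfl]
  rw [hzero, hat] at hstep
  rw [htail] at hstep'
  push_cast at hstep
  have hq0 : 0 < q := by linarith
  have hshift : digitValue q (fun i => truncateWith a n (a n + 1) 0 (n + i)) =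
      digitValue q fun i => a (n + i) := mul_left_cancel₀ hq0.ne' (by linarith)
  rw [hshift, sub_self] at hsub
  have := (mul_eq_zero.mp hsub).resolve_left (by positivity)
  rw [show x = digitValue q a from ha.2]
  exact (sub_eq_zero.mp this).symm

theorem truncateWith_succ_ne (a : ℕ → ℕ) {m n : ℕ} (hmn : m < n) :
    truncateWith a m (a m + 1) 0 ≠ truncateWith a n (a n + 1) 0 := by
  intro heq
  have := congrFun heq m
  rw [truncateWith, if_neg (lt_irrefl m), if_pos rfl, truncateWith, if_pos hmn] at this
  omega

/-- If `q ∈ V \ closure(U)`, then every `x ∈ V_q \ U_q` has countably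
infinitely many expansions in base `q`, and its greedy expansion is finite. -/
theorem expansions_in_V_minus_closureU (q : ℝ) (hq : q ∈ VSet) (h : q ∉ closure USet)
    (x : ℝ) (hx : x ∈ Vq q \ Uq q) :
    {c | IsExpansionOf q x c}.Countable ∧ {c | IsExpansionOf q x c}.Infinite ∧
      {i | greedy q x i ≠ 0}.Finite := by
  have hq1 : 1 < q := hq.1
  obtain ⟨⟨hxJ, hxV⟩, hxU⟩ := hx
  set A := alphaOne q
  set α := quasiGreedySeq q 1
  have hone : quasiGreedy q 1 = α := quasiGreedy_eq hq1 one_pos (one_le_alphaOne_div hq1)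
  have hA : 0 < A := (alphaOne_bounds hq1).1
  have hα0 : α 0 = A := quasiGreedySeq_one_zero hq1
  have hαA : ∀ i, α i ≤ A := quasiGreedySeq_le q 1
  have hα1 : digitValue q α = 1 := digitValue_quasiGreedySeq hq1 one_pos (one_le_alphaOne_div hq1)
  have hαinf : InfiniteSeq α :=
    (isQuasiGreedyOf_quasiGreedySeq hq1 one_pos (one_le_alphaOne_div hq1)).2.1
  -- the sequence `α` reproduces itself up to conjugation
  obtain ⟨k, hk⟩ : ∃ k, (fun i => A - α (k + 1 + i)) = α := by
    by_contra! hne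
    refine h (mem_closure_USet hq1 fun n => ?_)
    have := hq.2 n
    rw [hone] at this
    exact this.resolve_right (hne n)
  have hconj : ∀ i, α (k + 1 + i) = A - α i := fun i => by
    have h1 := congrFun hk i
    have h2 := hαA (k + 1 + i)
    beta_reduce at h1
    omega
  have hperiod : ∀ j i, α (2 * (k + 1) * j + i) = α i := by
    intro j
    induction j with
    | zero => simp
    | succ j ih =>
      intro i
      have h2 := hαA i
      rw [← ih i, show 2 * (k + 1) * (j + 1) + i = k + 1 + (k + 1 + (2 * (k + 1) * j + i)) by ring,
        hconj, hconj, ih]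
      omega
  have hαk : 0 < α k := by
    by_contra! hzero
    have hlast : α (k + 1 + k) = A := by rw [hconj]; omega
    have hshift : ∀ i, α (k + 1 + k + 1 + i) = α i := fun i => by
      rw [← hperiod 1 i]; congr 1; ring
    have hval := digitValue_shift_step hq1 hαA (k + 1 + k)
    simp only [hshift] at hval
    rw [hlast, hα1] at hval
    have hle := digitValue_le_one hq1 hαA hα1 (fun i => hαA (k + 1 + k + i))
      (quasiGreedySeq_one_tail_le hq1 _) fun n _ => by
        simpa only [add_assoc] using quasiGreedySeq_one_tail_le hq1 (k + 1 + k + (n + 1))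
    have hqA : q ≤ A + 1 := (alphaOne_bounds hq1).2.2
    have hq_eq : digitValue q α = A / (q - 1) := by
      rw [hα1, eq_div_iff (by linarith)]
      nlinarith
    have hconjval := digitValue_conj hq1 hαA
    rw [digitValue_const hq1, ← hq_eq, sub_self] at hconjval
    have h0 := digitValue_eq_zero hq1 (fun i => Nat.sub_le A (α i)) hconjval k
    omega
  have hx0 : 0 < x := by
    rcases hxJ.1.lt_or_eq with hpos | rfl
    · exact hpos
    · refine (hxU ⟨fun _ => 0, ⟨fun _ => Nat.zero_le _, by simp⟩, fun c hc => ?_⟩).elim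
      funext i
      exact digitValue_eq_zero hq1 hc.1 hc.2.symm i
  set a := quasiGreedySeq q x
  have hqg : IsQuasiGreedyOf q x a := isQuasiGreedyOf_quasiGreedySeq hq1 hx0 hxJ.2
  have haA : ∀ i, a i ≤ A := quasiGreedySeq_le q x
  rw [quasiGreedy_eq hq1 hx0 hxJ.2, hone] at hxV
  have hdev : ∀ c, IsExpansionOf q x c → c ≠ a →
      ∃ n, ((fun i => a (n + 1 + i)) = α ∧ a n < A ∧ c = truncateWith a n (a n + 1) 0) ∨
        ((fun i => A - a (n + 1 + i)) = α ∧ c = truncateWith a n (a n - 1) A) := by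
    intro c hc hne
    have hval : digitValue q c = digitValue q a := hc.2.symm.trans hqg.1.2
    rcases lexLt_or_lexLt_of_ne hne with ⟨n, heq, hn⟩ | ⟨n, heq, hn⟩
    · have heq' : ∀ i, i < n → a i = c i := fun i hi => (heq i hi).symm
      obtain ⟨h1, h2, h3⟩ := downward_deviation hq1 hαA hα1 hαinf haA hc.1 hxV hval heq' hn
      refine ⟨n, Or.inr ⟨h1, ?_⟩⟩
      rw [h2, Nat.add_sub_cancel]
      exact eq_truncateWith heq' h3
    · obtain ⟨h1, h2, h3⟩ := upward_deviation hq1 hαA hα1 hαinf haA hc.1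
        (fun m hm => quasiGreedySeq_tail_le hq1 hx0 hxJ.2 hm) hval heq hn
      refine ⟨n, Or.inl ⟨h1, hn.trans_le (hc.1 n), ?_⟩⟩
      rw [← h2]
      exact eq_truncateWith heq h3
  -- the quasi-greedy expansion of `x` has a nonmaximal digit followed by `α`
  obtain ⟨N, hN, hNA⟩ : ∃ N, (∀ i, a (N + 1 + i) = α i) ∧ a N < A := by
    obtain ⟨c, hc, hne⟩ : ∃ c, IsExpansionOf q x c ∧ c ≠ a := by
      by_contra! hall
      exact hxU ⟨a, hqg.1, hall⟩
    obtain ⟨n, ⟨h1, h2, -⟩ | ⟨h1, -⟩⟩ := hdev c hc hne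
    · exact ⟨n, congrFun h1, h2⟩
    · have hflip : ∀ i, a (n + 1 + i) = A - α i := fun i => by
        have h2 := congrFun h1 i
        have h3 := haA (n + 1 + i)
        beta_reduce at h2
        omega
      refine ⟨n + 1 + k, fun i => ?_, by rw [hflip]; omega⟩
      have := hαA i
      rw [show n + 1 + k + 1 + i = n + 1 + (k + 1 + i) by ring, hflip, hconj]
      omega
  have hNj : ∀ j, a (N + 2 * (k + 1) * j) < A ∧
      ∀ i, a (N + 2 * (k + 1) * j + 1 + i) = α i := by
    intro j
    refine ⟨?_, fun i => ?_⟩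
    · rcases j with _ | j
      · simpa using hNA
      · rw [show N + 2 * (k + 1) * (j + 1) = N + 1 + (2 * (k + 1) * j + (k + 1 + k)) by ring,
          hN, hperiod, hconj]
        omega
    · rw [show N + 2 * (k + 1) * j + 1 + i = N + 1 + (2 * (k + 1) * j + i) by ring, hN, hperiod]
  have hexp : ∀ j, IsExpansionOf q x
      (truncateWith a (N + 2 * (k + 1) * j) (a (N + 2 * (k + 1) * j) + 1) 0) := fun j =>
    truncateWith_succ_isExpansionOf hq1 hqg.1 (hNj j).1 (by simp only [(hNj j).2]; exact hα1)
  refine ⟨?_, ?_, ?_⟩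
  · refine (((Set.countable_singleton a).union
      (Set.countable_range fun n => truncateWith a n (a n + 1) 0)).union
      (Set.countable_range fun n => truncateWith a n (a n - 1) A)).mono fun c hc => ?_
    by_cases hca : c = a
    · exact Or.inl (Or.inl hca)
    · obtain ⟨n, ⟨-, -, hn⟩ | ⟨-, hn⟩⟩ := hdev c hc hca
      · exact Or.inl (Or.inr ⟨n, hn.symm⟩)
      · exact Or.inr ⟨n, hn.symm⟩
  · refine Set.infinite_of_injective_forall_mem (fun i j hij => ?_) hexp
    by_contra hne
    rcases lt_or_gt_of_ne hne with hlt | hlt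
    · exact truncateWith_succ_ne a (by gcongr) hij
    · exact truncateWith_succ_ne a (by gcongr) hij.symm
  · rw [greedy]
    split_ifs with hgr
    · by_contra hinf
      have hb := hgr.choose_spec
      have hle := hqg.2.2 _ hb.1 hinf
      have hge := hb.2 _ (hexp 0)
      have hlt : LexLt a (truncateWith a (N + 2 * (k + 1) * 0) (a (N + 2 * (k + 1) * 0) + 1) 0) :=
        ⟨N + 2 * (k + 1) * 0, fun i hi => (if_pos hi).symm, by
          rw [truncateWith, if_neg (lt_irrefl _), if_pos rfl]; omega⟩
      have hba : LexLe a hgr.choose := hb.2 _ hqg.1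
      rw [hle.antisymm hba] at hge
      rcases hge with hge | hge
      · exact hlt.asymm hge
      · exact hlt.ne hge.symm
    · simp
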